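/- arXiv:1705.10374 — 10 statements merged into one kernel-verified Lean document; each statement's English description precedes it below -/
import Mathlib

section
/- Let a > 0, b > 0, c > 0, d ∈ ℝ, ε ≥ 0 and p ≥ 0, and let g₁(x) = (c · x^ε · (x + d)^p / log(x + d))^b for x large enough that x + d > 1. Then lim_{x→∞} log((1 + g₁(x))^(−a)) / log x = −a·b·(ε + p); that is, the survival function F̄(x) = (1 + g₁(x))^(−a) has tail index ab(ε + p) in the Karamata sense. -/
/-- Karamata-type tail index of the survival function based on
`g₁(x) = (c x^ε (x+d)^p / log(x+d))^b`:
`log((1 + g₁(x))^(-a)) / log x → -(a*b*(ε+p))` as `x → ∞`. -/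
theorem ebxii_g1_tail_index (a b c d ε p : ℝ) (ha : 0 < a) (hb : 0 < b) (hc : 0 < c)
    (hε : 0 ≤ ε) (hp : 0 ≤ p) :
    Filter.Tendsto
      (fun x : ℝ =>
        Real.log ((1 + (c * x ^ ε * (x + d) ^ p / Real.log (x + d)) ^ b) ^ (-a)) /
          Real.log x)
      Filter.atTop (nhds (-(a * b * (ε + p)))) := by
  have hxd : Filter.Tendsto (fun x : ℝ => x + d) Filter.atTop Filter.atTop :=
    Filter.tendsto_atTop_add_const_right _ _ Filter.tendsto_id
  have hl := Real.tendsto_log_atTop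
  have hld := hl.comp hxd
  have h0 : ∀ k : ℝ, Filter.Tendsto (fun x : ℝ => k / Real.log x) Filter.atTop (nhds 0) :=
    fun k => hl.const_div_atTop k
  have h1 : Filter.Tendsto (fun x : ℝ => Real.log (x + d) / Real.log x) Filter.atTop (nhds 1) := by
    have h := (Real.tendsto_log_comp_add_sub_log d).mul (h0 1)
    have h := h.const_add 1
    simp only [mul_zero, add_zero] at h
    refine h.congr' ?_
    filter_upwards [hl.eventually_gt_atTop 0] with x hx
    field_simp
    ring
  have h2 : Filter.Tendsto (fun x : ℝ => Real.log (Real.log (x + d)) / Real.log x)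
      Filter.atTop (nhds 0) := by
    have h := (Real.isLittleO_log_id_atTop.tendsto_div_nhds_zero.comp hld).mul h1
    simp only [zero_mul] at h
    refine h.congr' ?_
    filter_upwards [hl.eventually_gt_atTop 0, hld.eventually_gt_atTop 0] with x hx hx'
    simp only [Function.comp, id] at hx' ⊢
    field_simp
  have h3 : Filter.Tendsto (fun x : ℝ => b * (Real.log c / Real.log x + ε
      + p * (Real.log (x + d) / Real.log x) - Real.log (Real.log (x + d)) / Real.log x))
      Filter.atTop (nhds (b * (ε + p))) := by
    have h := (((((h0 (Real.log c)).add_const ε).add (h1.const_mul p)).sub h2).const_mul b)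
    convert h using 2
    ring
  have h4 := h3.max (tendsto_const_nhds (x := (0 : ℝ)))
  rw [max_eq_left (by positivity)] at h4
  have h5 := h4.add (h0 (Real.log 2))
  rw [add_zero] at h5
  have key : ∀ᶠ x : ℝ in Filter.atTop, ∃ u : ℝ,
      (c * x ^ ε * (x + d) ^ p / Real.log (x + d)) ^ b = Real.exp u ∧
      b * (Real.log c / Real.log x + ε
      + p * (Real.log (x + d) / Real.log x) - Real.log (Real.log (x + d)) / Real.log x)
        = u / Real.log x := by
    filter_upwards [hl.eventually_gt_atTop 0, hld.eventually_gt_atTop 0,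
      hxd.eventually_gt_atTop 0, Filter.eventually_gt_atTop 0] with x hx hx' hx1 hx2
    simp only [Function.comp] at hx'
    have e1 : 0 < x ^ ε := Real.rpow_pos_of_pos hx2 _
    have e2 : 0 < (x + d) ^ p := Real.rpow_pos_of_pos hx1 _
    have e3 : 0 < c * x ^ ε * (x + d) ^ p / Real.log (x + d) := by positivity
    refine ⟨Real.log (c * x ^ ε * (x + d) ^ p / Real.log (x + d)) * b,
      Real.rpow_def_of_pos e3 _, ?_⟩
    rw [Real.log_div (by positivity) hx'.ne', Real.log_mul (by positivity) e2.ne',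
      Real.log_mul hc.ne' e1.ne', Real.log_rpow hx2, Real.log_rpow hx1]
    field_simp
  have h6 : Filter.Tendsto (fun x : ℝ =>
      Real.log (1 + (c * x ^ ε * (x + d) ^ p / Real.log (x + d)) ^ b) / Real.log x)
      Filter.atTop (nhds (b * (ε + p))) := by
    refine tendsto_of_tendsto_of_tendsto_of_le_of_le' h4 h5 ?_ ?_
    · filter_upwards [key, hl.eventually_gt_atTop 0] with x ⟨u, hu, hu'⟩ hx
      rw [hu, hu']
      have hp := Real.exp_pos u
      refine max_le ?_ (div_nonneg (Real.log_nonneg (by linarith)) hx.le)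
      gcongr
      rw [Real.le_log_iff_exp_le (by positivity)]
      linarith
    · filter_upwards [key, hl.eventually_gt_atTop 0] with x ⟨u, hu, hu'⟩ hx
      rw [hu, hu']
      have hm : max (u / Real.log x) 0 = max u 0 / Real.log x := by
        rw [← max_div_div_right hx.le, zero_div]
      rw [hm, ← add_div]
      gcongr
      rw [Real.log_le_iff_le_exp (by positivity), Real.exp_add, Real.exp_log (by norm_num)]
      have i1 : Real.exp u ≤ Real.exp (max u 0) := Real.exp_le_exp.2 (le_max_left _ _)
      have i2 : 1 ≤ Real.exp (max u 0) := Real.one_le_exp (le_max_right _ _)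
      linarith
  have h7 := h6.const_mul (-a)
  rw [show -(a * b * (ε + p)) = -a * (b * (ε + p)) by ring]
  refine h7.congr' ?_
  filter_upwards [key] with x ⟨u, hu, _⟩
  rw [hu, Real.log_rpow (by positivity), mul_div_assoc]
end

section
/- Let a > 0, b ≥ 0, c > 0, d ∈ ℝ and ε ≥ 0, and let g₂(x) = (c · x^ε / log(x + d))^b · e (the case p = 0 of g₂(x) = (c · x^ε / log(x + d))^b · e^{x^p}), defined for x large enough that x + d > 1. Then lim_{x→∞} log((1 + g₂(x))^(−a)) / log x = −a·b·ε; that is, the survival function F̄(x) = (1 + g₂(x))^(−a) has tail index abε in the Karamata sense. -/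
open Filter in
theorem aux_loglog (d : ℝ) :
    Tendsto (fun x : ℝ => Real.log (Real.log (x + d)) / Real.log x) atTop (nhds 0) := by
  have h1 : Tendsto (fun x : ℝ => Real.log (Real.log x) / Real.log x) atTop (nhds 0) :=
    (Real.isLittleO_log_id_atTop.tendsto_div_nhds_zero).comp Real.tendsto_log_atTop
  have h2 : Tendsto (fun x : ℝ => Real.log 2 / Real.log x) atTop (nhds 0) :=
    tendsto_const_nhds.div_atTop Real.tendsto_log_atTop
  have h3 := h2.add h1
  rw [add_zero] at h3
  refine tendsto_of_tendsto_of_tendsto_of_le_of_le' tendsto_const_nhds h3 ?_ ?_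
  all_goals
    filter_upwards [eventually_ge_atTop (2 + |d|), eventually_ge_atTop (Real.exp 1 - d)] with x hx hx'
    have hd := le_abs_self d
    have hd0 := abs_nonneg d
    have hl : 0 < Real.log x := Real.log_pos (by linarith)
    have he := Real.exp_pos 1
    have h4 : 1 ≤ Real.log (x + d) := by
      rw [Real.le_log_iff_exp_le (by linarith)]
      linarith
  · exact div_nonneg (Real.log_nonneg h4) hl.le
  · rw [← add_div, ← Real.log_mul (by norm_num) hl.ne']
    have h5 : Real.log (x + d) ≤ 2 * Real.log x := by
      have : Real.log (x ^ 2) = 2 * Real.log x := by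
        rw [Real.log_pow]; norm_num
      rw [← this]
      exact Real.log_le_log (by linarith) (by nlinarith)
    have h6 := Real.log_le_log (by linarith) h5
    gcongr

/-- Karamata-type tail index of the survival function based on
`g₂(x) = (c x^ε / log(x+d))^b * e^{x^p}` in the case `p = 0`, i.e.
`g₂(x) = (c x^ε / log(x+d))^b * e`:
`log((1 + g₂(x))^(-a)) / log x → -(a*b*ε)` as `x → ∞`. -/
theorem ebxii_g2_tail_index_p_zero (a b c d ε : ℝ) (ha : 0 < a) (hb : 0 ≤ b)
    (hc : 0 < c) (hε : 0 ≤ ε) :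
    Filter.Tendsto
      (fun x : ℝ =>
        Real.log ((1 + (c * x ^ ε / Real.log (x + d)) ^ b * Real.exp 1) ^ (-a)) /
          Real.log x)
      Filter.atTop (nhds (-(a * b * ε))) := by
  have hL : 0 ≤ b * ε := mul_nonneg hb hε
  have hlog := Real.tendsto_log_atTop
  have hk : Filter.Tendsto (fun x : ℝ => (b * Real.log c + 1) / Real.log x)
      Filter.atTop (nhds 0) := tendsto_const_nhds.div_atTop hlog
  have hk2 : Filter.Tendsto (fun x : ℝ => Real.log 2 / Real.log x)
      Filter.atTop (nhds 0) := tendsto_const_nhds.div_atTop hlog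
  have hH : Filter.Tendsto (fun x : ℝ => max 0 ((b * Real.log c + 1) / Real.log x + b * ε
      - b * (Real.log (Real.log (x + d)) / Real.log x))) Filter.atTop (nhds (b * ε)) := by
    have h := (tendsto_const_nhds (x := (0 : ℝ))).max
      ((hk.add_const (b * ε)).sub ((aux_loglog d).const_mul b))
    simpa [hL] using h
  have hU := hk2.add hH
  rw [zero_add] at hU
  have key : ∀ᶠ x : ℝ in Filter.atTop, 0 < x ∧ 0 < Real.log x ∧ 0 < Real.log (x + d) := by
    filter_upwards [Filter.eventually_gt_atTop 1, Filter.eventually_gt_atTop (1 - d)] with x h1 h2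
    exact ⟨by linarith, Real.log_pos h1, Real.log_pos (by linarith)⟩
  have hrepr : ∀ x : ℝ, 0 < x → 0 < Real.log x → 0 < Real.log (x + d) →
      (c * x ^ ε / Real.log (x + d)) ^ b * Real.exp 1 = Real.exp (Real.log x *
        ((b * Real.log c + 1) / Real.log x + b * ε
      - b * (Real.log (Real.log (x + d)) / Real.log x))) := by
    intro x hx hl hl2
    have hxe := Real.rpow_pos_of_pos hx ε
    rw [Real.rpow_def_of_pos (by positivity), ← Real.exp_add,
      Real.log_div (by positivity) hl2.ne', Real.log_mul hc.ne' hxe.ne', Real.log_rpow hx]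
    congr 1
    field_simp
    ring
  have main : Filter.Tendsto (fun x : ℝ =>
      Real.log (1 + (c * x ^ ε / Real.log (x + d)) ^ b * Real.exp 1) / Real.log x)
      Filter.atTop (nhds (b * ε)) := by
    refine tendsto_of_tendsto_of_tendsto_of_le_of_le' hH hU ?_ ?_
    all_goals
      filter_upwards [key] with x hx
      obtain ⟨hx, hl, hl2⟩ := hx
      rw [hrepr x hx hl hl2]
      generalize (b * Real.log c + 1) / Real.log x + b * ε
        - b * (Real.log (Real.log (x + d)) / Real.log x) = t
      have he := Real.exp_pos (Real.log x * t)
    · rw [le_div_iff₀ hl]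
      rcases le_total 0 t with ht | ht
      · rw [max_eq_right ht, Real.le_log_iff_exp_le (by linarith), mul_comm t]
        linarith
      · rw [max_eq_left ht, zero_mul]
        exact Real.log_nonneg (by linarith)
    · rw [div_le_iff₀ hl, add_mul, div_mul_cancel₀ _ hl.ne',
        Real.log_le_iff_le_exp (by linarith), Real.exp_add, Real.exp_log (by norm_num)]
      have h1 : Real.exp (Real.log x * t) ≤ Real.exp (max 0 t * Real.log x) := by
        rw [Real.exp_le_exp, mul_comm]
        exact mul_le_mul_of_nonneg_right (le_max_right _ _) hl.le
      have h2 : 1 ≤ Real.exp (max 0 t * Real.log x) :=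
        Real.one_le_exp (mul_nonneg (le_max_left _ _) hl.le)
      linarith
  have hfin := main.const_mul (-a)
  rw [show -(a * b * ε) = -a * (b * ε) by ring]
  refine hfin.congr' ?_
  filter_upwards [key] with x hx
  obtain ⟨hx, hl, hl2⟩ := hx
  have hp := Real.rpow_pos_of_pos hx ε
  have hpos : 0 < 1 + (c * x ^ ε / Real.log (x + d)) ^ b * Real.exp 1 := by positivity
  rw [Real.log_rpow hpos]
  exact (mul_div_assoc _ _ _).symm
end

section
/- Let a > 0, b > 0, c > 0, d ∈ ℝ and ε ≥ 0, and let g₃(x) = (c · x^ε · log(x + d + 1) / log(x + d))^b, defined for x large enough that x + d > 1. Then lim_{x→∞} log((1 + g₃(x))^(−a)) / log x = −a·b·ε; that is, the survival function F̄(x) = (1 + g₃(x))^(−a) has tail index abε in the Karamata sense. -/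
/-- Karamata-type tail index of the survival function based on
`g₃(x) = (c x^ε log(x+d+1) / log(x+d))^b`:
`log((1 + g₃(x))^(-a)) / log x → -(a*b*ε)` as `x → ∞`. -/
theorem ebxii_g3_tail_index (a b c d ε : ℝ) (ha : 0 < a) (hb : 0 < b) (hc : 0 < c)
    (hε : 0 ≤ ε) :
    Filter.Tendsto
      (fun x : ℝ =>
        Real.log
            ((1 + (c * x ^ ε * Real.log (x + d + 1) / Real.log (x + d)) ^ b) ^ (-a)) /
          Real.log x)
      Filter.atTop (nhds (-(a * b * ε))) := by
  have key : ∀ x : ℝ, 2 ≤ x → 2 ≤ x + d →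
      0 < (c * x ^ ε * Real.log (x + d + 1) / Real.log (x + d)) ^ b ∧
      b * Real.log c + b * ε * Real.log x ≤
        Real.log (1 + (c * x ^ ε * Real.log (x + d + 1) / Real.log (x + d)) ^ b) ∧
      Real.log (1 + (c * x ^ ε * Real.log (x + d + 1) / Real.log (x + d)) ^ b) ≤
        Real.log (1 + (2 * c) ^ b) + b * ε * Real.log x := by
    intro x hx hxd
    have hx0 : 0 < x := by linarith
    have hl : 0 < Real.log (x + d) := Real.log_pos (by linarith)
    have h1 : Real.log (x + d) ≤ Real.log (x + d + 1) :=
      Real.log_le_log (by linarith) (by linarith)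
    have h2 : Real.log (x + d + 1) ≤ 2 * Real.log (x + d) := by
      have : Real.log ((x + d) ^ 2) = 2 * Real.log (x + d) := by
        rw [Real.log_pow]; norm_num
      rw [← this]
      exact Real.log_le_log (by linarith) (by nlinarith)
    have hxe : 0 < x ^ ε := Real.rpow_pos_of_pos hx0 _
    have hP : 0 < c * x ^ ε := by positivity
    have lo : c * x ^ ε ≤ c * x ^ ε * Real.log (x + d + 1) / Real.log (x + d) := by
      rw [le_div_iff₀ hl]
      exact mul_le_mul_of_nonneg_left h1 hP.le
    have hi : c * x ^ ε * Real.log (x + d + 1) / Real.log (x + d) ≤ (2 * c) * x ^ ε := by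
      rw [div_le_iff₀ hl]
      have := mul_le_mul_of_nonneg_left h2 hP.le
      linarith
    have hG := lt_of_lt_of_le hP lo
    generalize c * x ^ ε * Real.log (x + d + 1) / Real.log (x + d) = G at *
    have hGb : 0 < G ^ b := Real.rpow_pos_of_pos hG _
    have lo' : (c * x ^ ε) ^ b ≤ G ^ b := Real.rpow_le_rpow hP.le lo hb.le
    have hi' : G ^ b ≤ (2 * c * x ^ ε) ^ b := Real.rpow_le_rpow hG.le hi hb.le
    refine ⟨hGb, ?_, ?_⟩
    · have : Real.log ((c * x ^ ε) ^ b) = b * Real.log c + b * ε * Real.log x := by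
        rw [Real.log_rpow hP, Real.log_mul hc.ne' hxe.ne', Real.log_rpow hx0]; ring
      rw [← this]
      exact Real.log_le_log (Real.rpow_pos_of_pos hP _) (by linarith)
    · have hq : 0 < (2 * c) ^ b := Real.rpow_pos_of_pos (by linarith) _
      have hxb : 0 < (x ^ ε) ^ b := Real.rpow_pos_of_pos hxe _
      have hxb1 : 1 ≤ (x ^ ε) ^ b :=
        Real.one_le_rpow (Real.one_le_rpow (by linarith) hε) hb.le
      have : Real.log ((1 + (2 * c) ^ b) * (x ^ ε) ^ b)
          = Real.log (1 + (2 * c) ^ b) + b * ε * Real.log x := by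
        rw [Real.log_mul (by linarith) hxb.ne', Real.log_rpow hxe, Real.log_rpow hx0]; ring
      rw [← this]
      apply Real.log_le_log (by linarith)
      rw [Real.mul_rpow (by linarith) hxe.le] at hi'
      nlinarith
  have lim : ∀ K : ℝ, Filter.Tendsto (fun x : ℝ => K / Real.log x + b * ε)
      Filter.atTop (nhds (b * ε)) := by
    intro K
    simpa using (Real.tendsto_log_atTop.const_div_atTop K).add_const (b * ε)
  have main : Filter.Tendsto (fun x : ℝ =>
      Real.log (1 + (c * x ^ ε * Real.log (x + d + 1) / Real.log (x + d)) ^ b) / Real.log x)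
      Filter.atTop (nhds (b * ε)) := by
    refine tendsto_of_tendsto_of_tendsto_of_le_of_le' (lim (b * Real.log c))
      (lim (Real.log (1 + (2 * c) ^ b))) ?_ ?_
    · filter_upwards [Filter.eventually_ge_atTop 2, Filter.eventually_ge_atTop (2 - d)]
        with x hx hxd
      have hl : 0 < Real.log x := Real.log_pos (by linarith)
      rw [le_div_iff₀ hl, add_mul, div_mul_cancel₀ _ hl.ne']
      exact (key x hx (by linarith)).2.1
    · filter_upwards [Filter.eventually_ge_atTop 2, Filter.eventually_ge_atTop (2 - d)]
        with x hx hxd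
      have hl : 0 < Real.log x := Real.log_pos (by linarith)
      rw [div_le_iff₀ hl, add_mul, div_mul_cancel₀ _ hl.ne']
      exact (key x hx (by linarith)).2.2
  have e : -(a * b * ε) = -a * (b * ε) := by ring
  rw [e]
  refine (main.const_mul (-a)).congr' ?_
  filter_upwards [Filter.eventually_ge_atTop 2, Filter.eventually_ge_atTop (2 - d)]
    with x hx hxd
  have := (key x hx (by linarith)).1
  rw [Real.log_rpow (by linarith)]
  exact (mul_div_assoc _ _ _).symm
end

section
/- Let a > 0, b > 0, c > 0 and d ∈ ℝ, and let g₀(x) = (c·(x + d))^b. Then the hazard function h(x) = a·g₀'(x)/(1 + g₀(x)) = a·b·c^b·(x + d)^(b−1)/(1 + (c·(x + d))^b) tends to 0 as x → ∞. -/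
/-- The hazard function of the Burr type XII distribution with `g₀(x) = (c(x+d))^b`,
`h(x) = a b c^b (x+d)^{b-1} / (1 + (c(x+d))^b)`, tends to `0` as `x → ∞`. -/
theorem burrXII_hazard_g0_tendsto_zero (a b c d : ℝ) (ha : 0 < a) (hb : 0 < b)
    (hc : 0 < c) :
    Filter.Tendsto
      (fun x : ℝ => a * b * c ^ b * (x + d) ^ (b - 1) / (1 + (c * (x + d)) ^ b))
      Filter.atTop (nhds 0) := by
  have hlin : Filter.Tendsto (fun x : ℝ => x + d) Filter.atTop Filter.atTop :=
    Filter.tendsto_atTop_add_const_right _ d Filter.tendsto_id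
  have hup : Filter.Tendsto (fun x : ℝ => a * b / (x + d)) Filter.atTop (nhds 0) :=
    hlin.const_div_atTop (a * b)
  have hpos : ∀ᶠ x : ℝ in Filter.atTop, 0 < x + d := hlin.eventually_gt_atTop 0
  refine squeeze_zero' ?_ ?_ hup
  · filter_upwards [hpos] with x hx
    positivity
  · filter_upwards [hpos] with x hx
    have h1 : (c * (x + d)) ^ b = c ^ b * (x + d) ^ b := Real.mul_rpow hc.le hx.le
    have h2 : (x + d) ^ (b - 1) * (x + d) = (x + d) ^ b := by
      rw [Real.rpow_sub_one hx.ne', div_mul_cancel₀ _ hx.ne']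
    have h3 : 0 < (c * (x + d)) ^ b := by positivity
    rw [div_le_div_iff₀ (by positivity) hx]
    calc a * b * c ^ b * (x + d) ^ (b - 1) * (x + d)
        = a * b * (c ^ b * ((x + d) ^ (b - 1) * (x + d))) := by ring
      _ = a * b * (c * (x + d)) ^ b := by rw [h2, h1]
      _ ≤ a * b * (1 + (c * (x + d)) ^ b) := by
        have hab : 0 < a * b := by positivity
        nlinarith
end

section
/- Let a > 0, b > 0, c > 0, d ∈ ℝ, ε ≥ 0 and p ≥ 0, and let g₁(x) = (c · x^ε · (x + d)^p / log(x + d))^b, defined for x large enough that x + d > 1. Then the hazard function h(x) = a·g₁'(x)/(1 + g₁(x)) tends to 0 as x → ∞. -/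
/-- The hazard function `h(x) = a g₁'(x)/(1 + g₁(x))` associated with
`g₁(x) = (c x^ε (x+d)^p / log(x+d))^b` tends to `0` as `x → ∞`. -/
theorem ebxii_hazard_g1_tendsto_zero (a b c d ε p : ℝ) (ha : 0 < a) (hb : 0 < b)
    (hc : 0 < c) (hε : 0 ≤ ε) (hp : 0 ≤ p) :
    Filter.Tendsto
      (fun x : ℝ =>
        a * deriv (fun y => (c * y ^ ε * (y + d) ^ p / Real.log (y + d)) ^ b) x /
          (1 + (c * x ^ ε * (x + d) ^ p / Real.log (x + d)) ^ b))
      Filter.atTop (nhds 0) := by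
  have hd : Filter.Tendsto (fun x : ℝ => x + d) Filter.atTop Filter.atTop :=
    Filter.tendsto_atTop_add_const_right _ d Filter.tendsto_id
  have h1 : Filter.Tendsto (fun x : ℝ => x⁻¹) Filter.atTop (nhds 0) := tendsto_inv_atTop_zero
  have h2 : Filter.Tendsto (fun x : ℝ => (x + d)⁻¹) Filter.atTop (nhds 0) :=
    tendsto_inv_atTop_zero.comp hd
  have h3 : Filter.Tendsto (fun x : ℝ => (Real.log (x + d))⁻¹) Filter.atTop (nhds 0) :=
    tendsto_inv_atTop_zero.comp (Real.tendsto_log_atTop.comp hd)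
  have hL : Filter.Tendsto (fun x : ℝ => |a * (b * (ε * x⁻¹ + p * (x + d)⁻¹
      - (x + d)⁻¹ * (Real.log (x + d))⁻¹))|) Filter.atTop (nhds 0) := by
    have := ((((h1.const_mul ε).add (h2.const_mul p)).sub (h2.mul h3)).const_mul b).const_mul a
    simpa using this.abs
  refine squeeze_zero_norm' ?_ hL
  filter_upwards [Filter.eventually_gt_atTop 0, hd.eventually_gt_atTop 1] with x hx hxd
  have hxd0 : 0 < x + d := by linarith
  have hlog : 0 < Real.log (x + d) := Real.log_pos hxd
  have hA : 0 < x ^ ε := Real.rpow_pos_of_pos hx _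
  have hB : 0 < (x + d) ^ p := Real.rpow_pos_of_pos hxd0 _
  have hq : 0 < c * x ^ ε * (x + d) ^ p / Real.log (x + d) := by positivity
  have e0 : HasDerivAt (fun y : ℝ => y + d) 1 x := (hasDerivAt_id x).add_const d
  have e1 : HasDerivAt (fun y : ℝ => y ^ ε) (1 * ε * x ^ (ε - 1)) x :=
    (hasDerivAt_id x).rpow_const (Or.inl hx.ne')
  have e2 : HasDerivAt (fun y : ℝ => (y + d) ^ p) (1 * p * (x + d) ^ (p - 1)) x :=
    e0.rpow_const (Or.inl hxd0.ne')
  have e3 : HasDerivAt (fun y : ℝ => Real.log (y + d)) (1 / (x + d)) x := e0.log hxd0.ne'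
  have e4 := (((e1.const_mul c).fun_mul e2).fun_div e3 hlog.ne').rpow_const (p := b) (Or.inl hq.ne')
  rw [e4.deriv, Real.rpow_sub_one hq.ne', Real.rpow_sub_one hx.ne', Real.rpow_sub_one hxd0.ne']
  have hG := Real.rpow_pos_of_pos hq b
  set G := (c * x ^ ε * (x + d) ^ p / Real.log (x + d)) ^ b
  have key : ∀ N : ℝ, N = (a * (b * (ε * x⁻¹ + p * (x + d)⁻¹
      - (x + d)⁻¹ * (Real.log (x + d))⁻¹))) * (G / (1 + G)) → ‖N‖ ≤ |a * (b * (ε * x⁻¹ + p * (x + d)⁻¹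
      - (x + d)⁻¹ * (Real.log (x + d))⁻¹))| := by
    rintro N rfl
    rw [Real.norm_eq_abs, abs_mul]
    apply mul_le_of_le_one_right (abs_nonneg _)
    rw [abs_of_pos (by positivity), div_le_one (by positivity)]
    linarith
  apply key
  clear_value G
  have : 1 + G ≠ 0 := by positivity
  generalize x ^ ε = A at *
  generalize (x + d) ^ p = B at *
  generalize Real.log (x + d) = l at *
  generalize x + d = z at *
  field_simp
end

section
/- Let a > 0, b ≥ 0, c > 0, d ∈ ℝ, ε ≥ 0 and 0 ≤ p < 1 with ε > 0 or p > 0, and let g₂(x) = (c · x^ε / log(x + d))^b · e^{x^p}, defined for x large enough that x + d > 1. Then the hazard function h(x) = a·g₂'(x)/(1 + g₂(x)) tends to 0 as x → ∞. -/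
/-- The hazard function `h(x) = a g₂'(x)/(1 + g₂(x))` associated with
`g₂(x) = (c x^ε / log(x+d))^b * e^{x^p}`, for `0 ≤ p < 1` with `ε > 0` or `p > 0`,
tends to `0` as `x → ∞`. -/
theorem ebxii_hazard_g2_p_lt_one (a b c d ε p : ℝ) (ha : 0 < a) (hb : 0 ≤ b)
    (hc : 0 < c) (hε : 0 ≤ ε) (hp0 : 0 ≤ p) (hp1 : p < 1) (hpos : 0 < ε ∨ 0 < p) :
    Filter.Tendsto
      (fun x : ℝ =>
        a * deriv (fun y => (c * y ^ ε / Real.log (y + d)) ^ b * Real.exp (y ^ p)) x /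
          (1 + (c * x ^ ε / Real.log (x + d)) ^ b * Real.exp (x ^ p)))
      Filter.atTop (nhds 0) := by
  have hd : Filter.Tendsto (fun x : ℝ => x + d) Filter.atTop Filter.atTop :=
    Filter.tendsto_atTop_add_const_right _ d Filter.tendsto_id
  have hL : Filter.Tendsto (fun x : ℝ => b * ε * x⁻¹ - b * ((x + d)⁻¹ * (Real.log (x + d))⁻¹)
      + p * x ^ (p - 1)) Filter.atTop (nhds 0) := by
    have h1 : Filter.Tendsto (fun x : ℝ => x⁻¹) Filter.atTop (nhds 0) := tendsto_inv_atTop_zero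
    have h2 := h1.comp hd
    have h3 := h1.comp (Real.tendsto_log_atTop.comp hd)
    have h4 : Filter.Tendsto (fun x : ℝ => x ^ (p - 1)) Filter.atTop (nhds 0) := by
      have := tendsto_rpow_neg_atTop (y := 1 - p) (by linarith)
      simpa using this
    have := ((h1.const_mul (b * ε)).sub ((h2.mul h3).const_mul b)).add (h4.const_mul p)
    simpa using this
  have hL2 := (hL.abs).const_mul a
  simp only [abs_zero, mul_zero] at hL2
  refine squeeze_zero_norm' ?_ hL2
  filter_upwards [Filter.eventually_gt_atTop 0, hd.eventually_gt_atTop 1] with x hx hxd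
  have hl : 0 < Real.log (x + d) := Real.log_pos hxd
  have hxd0 : 0 < x + d := by linarith
  have hxe : 0 < x ^ ε := Real.rpow_pos_of_pos hx _
  have hu : 0 < c * x ^ ε / Real.log (x + d) := by positivity
  have e1 : HasDerivAt (fun y : ℝ => c * y ^ ε) (c * (ε * x ^ (ε - 1))) x :=
    (Real.hasDerivAt_rpow_const (Or.inl hx.ne')).const_mul c
  have e2 : HasDerivAt (fun y : ℝ => Real.log (y + d)) (1 / (x + d)) x :=
    ((hasDerivAt_id x).add_const d).log hxd0.ne'
  have e3 : HasDerivAt (fun y : ℝ => (c * y ^ ε / Real.log (y + d)) ^ b) _ x :=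
    (e1.fun_div e2 hl.ne').rpow_const (p := b) (Or.inl hu.ne')
  have e4 : HasDerivAt (fun y : ℝ => Real.exp (y ^ p)) _ x :=
    (Real.hasDerivAt_rpow_const (p := p) (Or.inl hx.ne')).exp
  have e5 := (e3.fun_mul e4).deriv
  rw [e5, Real.rpow_sub_one hu.ne' b, Real.rpow_sub_one hx.ne' ε]
  have hU := Real.rpow_pos_of_pos hu b
  have hE := Real.exp_pos (x ^ p)
  generalize (c * x ^ ε / Real.log (x + d)) ^ b = U at *
  generalize Real.exp (x ^ p) = E at *
  generalize x ^ (p - 1) = q at *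
  generalize Real.log (x + d) = l at *
  generalize x ^ ε = X at *
  have key : ∀ M : ℝ, |a * (U * E * M) / (1 + U * E)| ≤ a * |M| := by
    intro M
    have hUE : 0 < U * E := mul_pos hU hE
    rw [abs_div, abs_mul, abs_mul, abs_of_pos ha, abs_of_pos hUE,
      abs_of_pos (by linarith : 0 < 1 + U * E), div_le_iff₀ (by linarith)]
    nlinarith [mul_nonneg ha.le (abs_nonneg M)]
  rw [Real.norm_eq_abs]
  convert key (b * ε * x⁻¹ - b * ((x + d)⁻¹ * l⁻¹) + p * q) using 4
  field_simp
  try ring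
end

section
/- Let a > 0, b ≥ 0, c > 0, d ∈ ℝ and ε ≥ 0, and let g₂(x) = (c · x^ε / log(x + d))^b · e^{x} (the case p = 1 of g₂(x) = (c · x^ε / log(x + d))^b · e^{x^p}), defined for x large enough that x + d > 1. Then the hazard function h(x) = a·g₂'(x)/(1 + g₂(x)) tends to a as x → ∞. -/
open Filter Topology in
/-- The hazard function `h(x) = a g₂'(x)/(1 + g₂(x))` associated with
`g₂(x) = (c x^ε / log(x+d))^b * e^{x}` (the case `p = 1`) tends to `a` as `x → ∞`. -/
theorem ebxii_hazard_g2_p_eq_one (a b c d ε : ℝ) (ha : 0 < a) (hb : 0 ≤ b)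
    (hc : 0 < c) (hε : 0 ≤ ε) :
    Filter.Tendsto
      (fun x : ℝ =>
        a * deriv (fun y => (c * y ^ ε / Real.log (y + d)) ^ b * Real.exp y) x /
          (1 + (c * x ^ ε / Real.log (x + d)) ^ b * Real.exp x))
      Filter.atTop (nhds a) := by
  have hg : Tendsto (fun x : ℝ => (c * x ^ ε / Real.log (x + d)) ^ b * Real.exp x)
      atTop atTop := by
    have h1 := (tendsto_exp_div_rpow_atTop b).const_mul_atTop
      (Real.rpow_pos_of_pos (half_pos hc) b)
    refine tendsto_atTop_mono' _ ?_ h1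
    filter_upwards [eventually_ge_atTop 1, eventually_ge_atTop d,
      eventually_gt_atTop (1 - d)] with x hx1 hxd hx
    have hx0 : 0 < x := by linarith
    have hl : 0 < Real.log (x + d) := Real.log_pos (by linarith)
    have hl2 : Real.log (x + d) ≤ 2 * x := by
      have := Real.log_le_sub_one_of_pos (show 0 < x + d by linarith)
      linarith
    have hp : 1 ≤ x ^ ε := Real.one_le_rpow hx1 hε
    have e1 : (c / 2) ^ b * (Real.exp x / x ^ b) = (c / 2 / x) ^ b * Real.exp x := by
      rw [Real.div_rpow (by positivity) hx0.le]; ring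
    rw [e1]
    have : c / 2 / x ≤ c * x ^ ε / Real.log (x + d) := by
      rw [div_div]
      apply div_le_div₀ (by positivity) _ hl hl2
      nlinarith
    gcongr
  have hlin : Tendsto (fun x : ℝ => x + d) atTop atTop := tendsto_atTop_add_const_right _ _ tendsto_id
  have hL : Tendsto (fun x : ℝ => b * ε / x - b / ((x + d) * Real.log (x + d)) + 1)
      atTop (𝓝 1) := by
    have h1 : Tendsto (fun x : ℝ => b * ε / x) atTop (𝓝 0) := tendsto_id.const_div_atTop _
    have h2 : Tendsto (fun x : ℝ => b / ((x + d) * Real.log (x + d))) atTop (𝓝 0) :=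
      (hlin.atTop_mul_atTop₀ (Real.tendsto_log_atTop.comp hlin)).const_div_atTop _
    simpa using (h1.sub h2).add_const 1
  have hR : Tendsto (fun x : ℝ =>
      1 - 1 / (1 + (c * x ^ ε / Real.log (x + d)) ^ b * Real.exp x)) atTop (𝓝 1) := by
    simpa using ((tendsto_atTop_add_const_left _ 1 hg).const_div_atTop 1).const_sub 1
  have hT := (hL.mul hR).const_mul a
  rw [one_mul, mul_one] at hT
  refine hT.congr' ?_
  filter_upwards [eventually_ge_atTop 1, eventually_gt_atTop (1 - d)] with x hx1 hx
  have hx0 : 0 < x := by linarith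
  have hxd : 0 < x + d := by linarith
  have hl : 0 < Real.log (x + d) := Real.log_pos (by linarith)
  have hp : 0 < x ^ ε := Real.rpow_pos_of_pos hx0 ε
  have hq : 0 < c * x ^ ε / Real.log (x + d) := by positivity
  have hd1 : HasDerivAt (fun y : ℝ => c * y ^ ε / Real.log (y + d)) _ x :=
    ((Real.hasDerivAt_rpow_const (p := ε) (Or.inl hx0.ne')).const_mul c).div
      (((hasDerivAt_id x).add_const d).log hxd.ne') hl.ne'
  have hd2 := (hd1.rpow_const (p := b) (Or.inl hq.ne')).mul (Real.hasDerivAt_exp x)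
  have hd3 : deriv (fun y => (c * y ^ ε / Real.log (y + d)) ^ b * Real.exp y) x = _ := hd2.deriv
  rw [hd3]
  have hG : 0 < (c * x ^ ε / Real.log (x + d)) ^ b := Real.rpow_pos_of_pos hq b
  simp only [id]
  rw [Real.rpow_sub_one hq.ne', Real.rpow_sub_one hx0.ne']
  generalize (c * x ^ ε / Real.log (x + d)) ^ b = G at *
  have hE := Real.exp_pos x
  generalize Real.exp x = E at *
  generalize x ^ ε = P at *
  generalize Real.log (x + d) = l at *
  have : 1 + G * E ≠ 0 := by positivity
  field_simp
  ring
end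

section
/- Let a > 0, b ≥ 0, c > 0, d ∈ ℝ, ε ≥ 0 and p > 1, and let g₂(x) = (c · x^ε / log(x + d))^b · e^{x^p}, defined for x large enough that x + d > 1. Then the hazard function h(x) = a·g₂'(x)/(1 + g₂(x)) tends to +∞ as x → ∞. -/
theorem ebxii_aux_deriv (b c d ε p x : ℝ) (hc : 0 < c) (hx : 0 < x) (hl : 0 < Real.log (x + d))
    (hxd : 0 < x + d) :
    HasDerivAt (fun y => (c * y ^ ε / Real.log (y + d)) ^ b * Real.exp (y ^ p))
      ((c * x ^ ε / Real.log (x + d)) ^ b * Real.exp (x ^ p) *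
        (b * ε / x - b / ((x + d) * Real.log (x + d)) + p * x ^ (p - 1))) x := by
  have h1 : HasDerivAt (fun y : ℝ => y ^ ε) (ε * x ^ (ε - 1)) x :=
    Real.hasDerivAt_rpow_const (Or.inl hx.ne')
  have h2 : HasDerivAt (fun y : ℝ => y ^ p) (p * x ^ (p - 1)) x :=
    Real.hasDerivAt_rpow_const (Or.inl hx.ne')
  have h3 : HasDerivAt (fun y : ℝ => Real.log (y + d)) (1 / (x + d)) x :=
    ((hasDerivAt_id x).add_const d).log hxd.ne'
  have hxe : 0 < x ^ ε := Real.rpow_pos_of_pos hx _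
  have hu : 0 < c * x ^ ε / Real.log (x + d) := by positivity
  have h4 := ((h1.const_mul c).fun_div h3 hl.ne').rpow_const (p := b) (Or.inl hu.ne')
  have h5 := h4.fun_mul h2.exp
  refine h5.congr_deriv ?_
  rw [Real.rpow_sub_one hu.ne', Real.rpow_sub_one hx.ne' ε]
  generalize (c * x ^ ε / Real.log (x + d)) ^ b = G
  generalize x ^ (p - 1) = P
  generalize Real.exp (x ^ p) = E
  generalize x ^ ε = X at *
  generalize Real.log (x + d) = l at *
  field_simp

/-- The hazard function `h(x) = a g₂'(x)/(1 + g₂(x))` associated with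
`g₂(x) = (c x^ε / log(x+d))^b * e^{x^p}`, for `p > 1`, tends to `+∞` as `x → ∞`. -/
theorem ebxii_hazard_g2_p_gt_one (a b c d ε p : ℝ) (ha : 0 < a) (hb : 0 ≤ b)
    (hc : 0 < c) (hε : 0 ≤ ε) (hp : 1 < p) :
    Filter.Tendsto
      (fun x : ℝ =>
        a * deriv (fun y => (c * y ^ ε / Real.log (y + d)) ^ b * Real.exp (y ^ p)) x /
          (1 + (c * x ^ ε / Real.log (x + d)) ^ b * Real.exp (x ^ p)))
      Filter.atTop Filter.atTop := by
  have hP : Filter.Tendsto (fun x : ℝ => p * x ^ (p - 1) - b) Filter.atTop Filter.atTop :=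
    Filter.tendsto_atTop_add_const_right _ (-b)
      ((tendsto_rpow_atTop (by linarith : 0 < p - 1)).const_mul_atTop (by linarith))
  have hQ : Filter.Tendsto (fun x : ℝ => a / 2 * (p * x ^ (p - 1) - b))
      Filter.atTop Filter.atTop := hP.const_mul_atTop (by linarith)
  refine Filter.tendsto_atTop_mono' _ ?_ hQ
  have hE : Filter.Tendsto (fun x : ℝ => (c / 2) ^ b * (Real.exp x / x ^ b))
      Filter.atTop Filter.atTop :=
    (tendsto_exp_div_rpow_atTop b).const_mul_atTop (by positivity)
  filter_upwards [hP.eventually_ge_atTop 0, hE.eventually_ge_atTop 1,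
    Filter.eventually_ge_atTop 1, Filter.eventually_ge_atTop d,
    Filter.eventually_ge_atTop (Real.exp 1 - d)] with x h1 h2 h3 h4 h5
  have hx : 0 < x := by linarith
  have he : Real.exp 1 ≤ x + d := by linarith
  have hxd1 : 1 ≤ x + d := le_trans (Real.one_le_exp zero_le_one) he
  have hxd : 0 < x + d := by linarith
  have hl1 : 1 ≤ Real.log (x + d) := (Real.le_log_iff_exp_le hxd).2 he
  have hl : 0 < Real.log (x + d) := by linarith
  rw [(ebxii_aux_deriv b c d ε p x hc hx hl hxd).deriv]
  have hg : 1 ≤ (c * x ^ ε / Real.log (x + d)) ^ b * Real.exp (x ^ p) := by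
    have hlog : Real.log (x + d) ≤ 2 * x := by
      have := Real.log_le_sub_one_of_pos hxd
      linarith
    have hxe : 1 ≤ x ^ ε := Real.one_le_rpow h3 hε
    have hu : (c / 2) / x ≤ c * x ^ ε / Real.log (x + d) := by
      rw [div_div]
      apply div_le_div₀ <;> first | positivity | nlinarith
    have hxp : x ≤ x ^ p := by
      simpa using Real.rpow_le_rpow_of_exponent_le h3 hp.le
    calc 1 ≤ (c / 2) ^ b * (Real.exp x / x ^ b) := h2
      _ = ((c / 2) / x) ^ b * Real.exp x := by
        rw [Real.div_rpow (by positivity) hx.le]; ring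
      _ ≤ _ := by gcongr
  generalize (c * x ^ ε / Real.log (x + d)) ^ b * Real.exp (x ^ p) = g at *
  have hL : p * x ^ (p - 1) - b ≤
      b * ε / x - b / ((x + d) * Real.log (x + d)) + p * x ^ (p - 1) := by
    have q1 : 0 ≤ b * ε / x := by positivity
    have q2 : b / ((x + d) * Real.log (x + d)) ≤ b := div_le_self hb (by nlinarith)
    linarith
  generalize b * ε / x - b / ((x + d) * Real.log (x + d)) + p * x ^ (p - 1) = L at *
  generalize p * x ^ (p - 1) - b = M at *
  rw [le_div_iff₀ (by linarith)]
  have k1 : M * (1 + g) ≤ L * (2 * g) :=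
    mul_le_mul hL (by linarith) (by linarith) (by linarith)
  nlinarith
end

section
/- Let a > 0, b > 0, c > 0, d ∈ ℝ and ε ≥ 0, and let g₃(x) = (c · x^ε · log(x + d + 1) / log(x + d))^b, defined for x large enough that x + d > 1. Then the hazard function h(x) = a·g₃'(x)/(1 + g₃(x)) = a·b·g₃(x)·(ε/x + 1/((x + d + 1)·log(x + d + 1)) − 1/((x + d)·log(x + d)))/(1 + g₃(x)) tends to 0 as x → ∞. -/
/-- The hazard function associated with `g₃(x) = (c x^ε log(x+d+1)/log(x+d))^b`,
`h(x) = a b g₃(x) (ε/x + 1/((x+d+1) log(x+d+1)) - 1/((x+d) log(x+d))) / (1 + g₃(x))`,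
tends to `0` as `x → ∞`. -/
theorem ebxii_hazard_g3_tendsto_zero (a b c d ε : ℝ) (ha : 0 < a) (hb : 0 < b)
    (hc : 0 < c) (hε : 0 ≤ ε) :
    Filter.Tendsto
      (fun x : ℝ =>
        a * b * (c * x ^ ε * Real.log (x + d + 1) / Real.log (x + d)) ^ b *
            (ε / x + 1 / ((x + d + 1) * Real.log (x + d + 1)) -
              1 / ((x + d) * Real.log (x + d))) /
          (1 + (c * x ^ ε * Real.log (x + d + 1) / Real.log (x + d)) ^ b))
      Filter.atTop (nhds 0) := by
  have h1 : Filter.Tendsto (fun x : ℝ => x + d) Filter.atTop Filter.atTop :=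
    Filter.tendsto_atTop_add_const_right _ _ Filter.tendsto_id
  have h2 : Filter.Tendsto (fun x : ℝ => x + d + 1) Filter.atTop Filter.atTop :=
    Filter.tendsto_atTop_add_const_right _ _ h1
  have key : Filter.Tendsto (fun y : ℝ => 1 / (y * Real.log y)) Filter.atTop (nhds 0) := by
    simp only [one_div]
    exact (Filter.tendsto_id.atTop_mul_atTop₀ Real.tendsto_log_atTop).inv_tendsto_atTop
  have hE : Filter.Tendsto (fun x : ℝ => ε / x) Filter.atTop (nhds 0) :=
    Filter.tendsto_id.const_div_atTop ε
  have hS := (((hE.add (key.comp h2)).sub (key.comp h1)).abs).const_mul (a * b)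
  simp only [Function.comp_def, add_zero, sub_zero, abs_zero, mul_zero] at hS
  refine squeeze_zero_norm' ?_ hS
  filter_upwards [Filter.eventually_gt_atTop 0, h1.eventually_gt_atTop 1] with x hx hxd
  have hl1 : 0 < Real.log (x + d) := Real.log_pos hxd
  have hl2 : 0 < Real.log (x + d + 1) := Real.log_pos (by linarith)
  have hG : 0 < (c * x ^ ε * Real.log (x + d + 1) / Real.log (x + d)) ^ b := by positivity
  generalize (c * x ^ ε * Real.log (x + d + 1) / Real.log (x + d)) ^ b = G at hG ⊢
  generalize ε / x + 1 / ((x + d + 1) * Real.log (x + d + 1)) -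
              1 / ((x + d) * Real.log (x + d)) = S
  have hab : 0 < a * b := mul_pos ha hb
  rw [Real.norm_eq_abs, abs_div, abs_mul, abs_mul, abs_of_pos hab, abs_of_pos hG,
    abs_of_pos (by linarith : 0 < 1 + G), div_le_iff₀ (by linarith)]
  have : 0 ≤ a * b * |S| := by positivity
  nlinarith
end

section
/- Let b > 0, c > 0, d ∈ ℝ, ε ≥ 0 and p ≥ 0, and let g₁(x) = (c · x^ε · (x + d)^p / log(x + d))^b. Then for every x > 0 with x + d > 1, the derivative g₁'(x) is nonnegative if and only if log(x + d) · (p·x + ε·(x + d)) ≥ x. In particular, under the condition log(x + d)·(p·x + ε·(x + d)) ≥ x for all x > 0 with x + d > 1, the function g₁ is nondecreasing on its domain. -/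
lemma g1_hasDerivAt (b c d ε p : ℝ) (hc : 0 < c) (x : ℝ) (hx : 0 < x) (hxd : 1 < x + d) :
    HasDerivAt (fun y => (c * y ^ ε * (y + d) ^ p / Real.log (y + d)) ^ b)
      ((c * x ^ ε * (x + d) ^ p / Real.log (x + d)) ^ b * b / (x * (x + d) * Real.log (x + d)) *
        (Real.log (x + d) * (p * x + ε * (x + d)) - x)) x := by
  have hL : 0 < Real.log (x + d) := Real.log_pos hxd
  have hd : 0 < x + d := by linarith
  have h0 : HasDerivAt (fun y : ℝ => y + d) 1 x := (hasDerivAt_id x).add_const d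
  have h1 : HasDerivAt (fun y : ℝ => y ^ ε) (ε * x ^ (ε - 1)) x :=
    Real.hasDerivAt_rpow_const (Or.inl hx.ne')
  have h2 := h0.rpow_const (p := p) (Or.inl hd.ne')
  have h3 := h0.log hd.ne'
  have hA : 0 < x ^ ε := Real.rpow_pos_of_pos hx _
  have hB : 0 < (x + d) ^ p := Real.rpow_pos_of_pos hd _
  have hG : 0 < c * x ^ ε * (x + d) ^ p / Real.log (x + d) := by positivity
  have h4 := (((h1.const_mul c).mul h2).div h3 hL.ne').rpow_const (p := b) (Or.inl hG.ne')
  refine h4.congr_deriv ?_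
  simp only [Pi.mul_apply, Pi.div_apply]
  rw [Real.rpow_sub_one hG.ne', Real.rpow_sub_one hx.ne', Real.rpow_sub_one hd.ne']
  generalize (c * x ^ ε * (x + d) ^ p / Real.log (x + d)) ^ b = G
  generalize x ^ ε = A at *
  generalize (x + d) ^ p = B at *
  generalize Real.log (x + d) = L at *
  field_simp
  ring

/-- For `g₁(x) = (c x^ε (x+d)^p / log(x+d))^b` on its domain
`{x | 0 < x ∧ 1 < x + d}`, the derivative `g₁'(x)` is nonnegative iff
`log(x+d) (p x + ε (x+d)) ≥ x`; if this condition holds throughout the domain,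
then `g₁` is nondecreasing on the domain. -/
theorem ebxii_g1_deriv_nonneg_iff (b c d ε p : ℝ) (hb : 0 < b) (hc : 0 < c)
    (hε : 0 ≤ ε) (hp : 0 ≤ p) :
    (∀ x : ℝ, 0 < x → 1 < x + d →
      (0 ≤ deriv (fun y => (c * y ^ ε * (y + d) ^ p / Real.log (y + d)) ^ b) x ↔
        x ≤ Real.log (x + d) * (p * x + ε * (x + d)))) ∧
    ((∀ x : ℝ, 0 < x → 1 < x + d → x ≤ Real.log (x + d) * (p * x + ε * (x + d))) →
      MonotoneOn (fun y => (c * y ^ ε * (y + d) ^ p / Real.log (y + d)) ^ b)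
        {x : ℝ | 0 < x ∧ 1 < x + d}) := by
  have key : ∀ x : ℝ, 0 < x → 1 < x + d →
      (0 ≤ deriv (fun y => (c * y ^ ε * (y + d) ^ p / Real.log (y + d)) ^ b) x ↔
        x ≤ Real.log (x + d) * (p * x + ε * (x + d))) := by
    intro x hx hxd
    have hL : 0 < Real.log (x + d) := Real.log_pos hxd
    have hd : 0 < x + d := by linarith
    rw [(g1_hasDerivAt b c d ε p hc x hx hxd).deriv, mul_nonneg_iff_of_pos_left, sub_nonneg]
    positivity
  refine ⟨key, fun h => ?_⟩
  have hS : {x : ℝ | 0 < x ∧ 1 < x + d} = Set.Ioi (max 0 (1 - d)) := by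
    ext x
    simp only [Set.mem_setOf_eq, Set.mem_Ioi, max_lt_iff, sub_lt_iff_lt_add]
  refine monotoneOn_of_deriv_nonneg ?_ ?_ ?_ ?_
  · rw [hS]; exact convex_Ioi _
  · intro x hx
    exact (g1_hasDerivAt b c d ε p hc x hx.1 hx.2).continuousAt.continuousWithinAt
  · intro x hx
    have hx := interior_subset hx
    exact (g1_hasDerivAt b c d ε p hc x hx.1 hx.2).differentiableAt.differentiableWithinAt
  · intro x hx
    have hx := interior_subset hx
    exact (key x hx.1 hx.2).2 (h x hx.1 hx.2)
end
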